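/- For every fixed ε > 0 there is a constant K = K(ε) such that for all integers n ≥ 1, | |Ch(n)| − ((24 + 24√3 + π(2√3 − 4))/3)·n² | ≤ K·n^{3/2 + ε}. -/

import Mathlib

open Real Set Filter

/-- The open interior of the box `B_{i,j}(n) = [i/n,(i+1)/n] × [j/n,(j+1)/n]`. -/
def boxInt (n : ℕ) (i j : ℤ) : Set (ℝ × ℝ) :=
  {p | (i : ℝ) / n < p.1 ∧ p.1 < ((i : ℝ) + 1) / n ∧
       (j : ℝ) / n < p.2 ∧ p.2 < ((j : ℝ) + 1) / n}

/-- The plane unit circle `C`. -/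
def unitCircle : Set (ℝ × ℝ) := {p | p.1 ^ 2 + p.2 ^ 2 = 1}

/-- The approximation `X(n)` of a set `X ⊆ ℝ²`: the boxes (encoded by their index
pairs `(i,j) ∈ ℤ²`) whose open interior intersects `X`. -/
def approx (n : ℕ) (X : Set (ℝ × ℝ)) : Set (ℤ × ℤ) :=
  {ij | (boxInt n ij.1 ij.2 ∩ X).Nonempty}

/-- `Ch(n)`: ordered pairs of boxes of `C(n)` containing interior points at
Euclidean distance greater than `√3`. -/
def longChords (n : ℕ) : Set ((ℤ × ℤ) × (ℤ × ℤ)) :=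
  {q | q.1 ∈ approx n unitCircle ∧ q.2 ∈ approx n unitCircle ∧
    ∃ a ∈ boxInt n q.1.1 q.1.2, ∃ b ∈ boxInt n q.2.1 q.2.2,
      Real.sqrt ((a.1 - b.1) ^ 2 + (a.2 - b.2) ^ 2) > Real.sqrt 3}

theorem divisor_bound (ε : ℝ) (hε : 0 < ε) :
    ∃ K : ℝ, 0 < K ∧ ∀ n : ℕ, 1 ≤ n → (n.divisors.card : ℝ) ≤ K * (n : ℝ) ^ ε := by
  obtain ⟨P, hP⟩ := exists_nat_ge ((2 : ℝ) ^ (1 / ε))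
  have hl2 : 0 < Real.log 2 := Real.log_pos (by norm_num)
  set A : ℝ := 1 + 1 / (ε * Real.log 2) with hA
  have hA1 : 1 ≤ A := by
    have : 0 < 1 / (ε * Real.log 2) := by positivity
    linarith
  refine ⟨A ^ P, by positivity, fun n hn => ?_⟩
  have hn0 : n ≠ 0 := by omega
  have key : ∀ p ∈ n.primeFactors, ((n.factorization p : ℝ) + 1) ≤
      (if p < P then A else 1) * ((p : ℝ) ^ (n.factorization p : ℝ)) ^ ε := by
    intro p hp
    have hp2 : 2 ≤ p := (Nat.prime_of_mem_primeFactors hp).two_le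
    set v := n.factorization p
    have hpp : (0 : ℝ) ≤ p := by positivity
    have hp2' : (2 : ℝ) ≤ p := by exact_mod_cast hp2
    rw [← Real.rpow_mul hpp]
    split_ifs with h
    · have h1 : (2 : ℝ) ^ ((v : ℝ) * ε) ≤ (p : ℝ) ^ ((v : ℝ) * ε) :=
        Real.rpow_le_rpow (by norm_num) hp2' (by positivity)
      have h2 : 1 + (v : ℝ) * ε * Real.log 2 ≤ (2 : ℝ) ^ ((v : ℝ) * ε) := by
        rw [Real.rpow_def_of_pos (by norm_num)]
        have := Real.add_one_le_exp (Real.log 2 * ((v : ℝ) * ε))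
        linarith
      have h3 : (v : ℝ) + 1 ≤ A * (1 + (v : ℝ) * ε * Real.log 2) := by
        have e : A * (1 + (v : ℝ) * ε * Real.log 2) =
            1 + v + 1 / (ε * Real.log 2) + v * ε * Real.log 2 := by
          rw [hA]; field_simp; ring
        rw [e]
        have : 0 < 1 / (ε * Real.log 2) := by positivity
        have : 0 ≤ v * ε * Real.log 2 := by positivity
        linarith
      calc (v : ℝ) + 1 ≤ _ := h3
        _ ≤ A * (p : ℝ) ^ ((v : ℝ) * ε) := by
          apply mul_le_mul_of_nonneg_left (h2.trans h1); linarith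
    · push Not at h
      have h1 : (2 : ℝ) ≤ (p : ℝ) ^ ε := by
        have : ((2 : ℝ) ^ (1 / ε)) ^ ε ≤ (p : ℝ) ^ ε :=
          Real.rpow_le_rpow (by positivity) (hP.trans (by exact_mod_cast h)) hε.le
        rwa [← Real.rpow_mul (by norm_num), one_div_mul_cancel hε.ne', Real.rpow_one] at this
      rw [one_mul, mul_comm, Real.rpow_mul hpp, Real.rpow_natCast]
      have h2 : (2 : ℝ) ^ v ≤ ((p : ℝ) ^ ε) ^ v := pow_le_pow_left₀ (by norm_num) h1 v
      have h3 : ((v + 1 : ℕ) : ℝ) ≤ ((2 ^ v : ℕ) : ℝ) := by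
        exact_mod_cast Nat.lt_two_pow_self
      push_cast at h3
      linarith
  have e1 : (n.divisors.card : ℝ) = ∏ p ∈ n.primeFactors, ((n.factorization p : ℝ) + 1) := by
    rw [Nat.card_divisors hn0]; push_cast; rfl
  have e2 : (n : ℝ) = ∏ p ∈ n.primeFactors, (p : ℝ) ^ (n.factorization p : ℝ) := by
    conv_lhs => rw [← Nat.prod_factorization_pow_eq_self hn0]
    rw [Finsupp.prod]
    push_cast
    simp [Nat.support_factorization]
  have e3 : (n : ℝ) ^ ε = ∏ p ∈ n.primeFactors, ((p : ℝ) ^ (n.factorization p : ℝ)) ^ ε := by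
    conv_lhs => rw [e2]
    rw [Real.finsetProd_rpow]
    intro i _; positivity
  rw [e1, e3]
  calc _ ≤ ∏ p ∈ n.primeFactors, (if p < P then A else 1) *
        ((p : ℝ) ^ (n.factorization p : ℝ)) ^ ε :=
        Finset.prod_le_prod (fun i _ => by positivity) key
    _ = (∏ p ∈ n.primeFactors, (if p < P then A else 1)) *
        ∏ p ∈ n.primeFactors, ((p : ℝ) ^ (n.factorization p : ℝ)) ^ ε :=
        Finset.prod_mul_distrib
    _ ≤ _ := by
        apply mul_le_mul_of_nonneg_right _ (Finset.prod_nonneg fun i _ => by positivity)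
        rw [Finset.prod_ite, Finset.prod_const, Finset.prod_const_one, mul_one]
        apply pow_le_pow_right₀ hA1
        calc _ ≤ (Finset.range P).card := by
              apply Finset.card_le_card
              intro p hp
              simp at hp
              simp [hp.2]
          _ = P := Finset.card_range P

/-- lattice points on the circle of radius `n` in the open first quadrant -/
def latPts (n : ℕ) : Finset (ℕ × ℕ) :=
  (Finset.Icc 1 n ×ˢ Finset.Icc 1 n).filter (fun p => p.1 ^ 2 + p.2 ^ 2 = n ^ 2)

theorem latPts_card_le (n : ℕ) (hn : 1 ≤ n) :
    (latPts n).card ≤ n.divisors.card * (Nat.sqrt n + 1) * 2 := by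
  classical
  let G : (ℕ × ℕ) × Bool → ℕ × ℕ := fun q =>
    let k := q.1.1
    let m := q.1.2
    let r := Nat.sqrt (n / k - m ^ 2)
    let u := k * ((m : ℤ) ^ 2 - (r : ℤ) ^ 2).natAbs
    let v := k * (2 * m * r)
    if q.2 then (u, v) else (v, u)
  have hsub : latPts n ⊆
      ((n.divisors ×ˢ Finset.range (Nat.sqrt n + 1)) ×ˢ (Finset.univ : Finset Bool)).image G := by
    rintro ⟨a, b⟩ hab
    simp only [latPts, Finset.mem_filter, Finset.mem_product, Finset.mem_Icc] at hab
    obtain ⟨⟨ha, hb⟩, hab⟩ := hab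
    have hpy : PythagoreanTriple (a : ℤ) b n := by
      unfold PythagoreanTriple
      have : ((a ^ 2 + b ^ 2 : ℕ) : ℤ) = ((n ^ 2 : ℕ) : ℤ) := by rw [hab]
      push_cast at this
      linarith
    obtain ⟨k, m, r, h1, h2⟩ := PythagoreanTriple.classification.mp hpy
    have hnk : n = k.natAbs * (m.natAbs ^ 2 + r.natAbs ^ 2) := by
      have e : ((m.natAbs ^ 2 + r.natAbs ^ 2 : ℕ) : ℤ) = m ^ 2 + r ^ 2 := by
        push_cast; simp [sq_abs]
      have : (n : ℤ).natAbs = (k * (m ^ 2 + r ^ 2)).natAbs := by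
        rcases h2 with h2 | h2
        · rw [h2]
        · rw [h2, neg_mul, Int.natAbs_neg]
      rw [Int.natAbs_natCast, Int.natAbs_mul, ← e, Int.natAbs_natCast] at this
      exact this
    have hk0 : 0 < k.natAbs := by
      rcases Nat.eq_zero_or_pos k.natAbs with h | h
      · rw [h] at hnk; omega
      · exact h
    have hr : Nat.sqrt (n / k.natAbs - m.natAbs ^ 2) = r.natAbs := by
      have : n / k.natAbs = m.natAbs ^ 2 + r.natAbs ^ 2 := by
        conv_lhs => rw [hnk]
        exact Nat.mul_div_cancel_left _ hk0
      rw [this, Nat.add_sub_cancel_left, Nat.sqrt_eq']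
    have hu : (k * (m ^ 2 - r ^ 2)).natAbs =
        k.natAbs * (((m.natAbs : ℤ)) ^ 2 - ((r.natAbs : ℤ)) ^ 2).natAbs := by
      rw [Int.natAbs_mul]; simp [sq_abs]
    have hv : (k * (2 * m * r)).natAbs = k.natAbs * (2 * m.natAbs * r.natAbs) := by
      simp [Int.natAbs_mul]
    have hmem : (k.natAbs, m.natAbs) ∈ n.divisors ×ˢ Finset.range (Nat.sqrt n + 1) := by
      rw [Finset.mem_product]
      refine ⟨Nat.mem_divisors.mpr ⟨⟨_, hnk⟩, by omega⟩, ?_⟩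
      simp only [Finset.mem_range, Nat.lt_succ_iff]
      rw [Nat.le_sqrt]
      have : m.natAbs * m.natAbs ≤ m.natAbs ^ 2 + r.natAbs ^ 2 := by nlinarith
      refine this.trans ?_
      conv_rhs => rw [hnk]
      exact Nat.le_mul_of_pos_left _ hk0
    rw [Finset.mem_image]
    rcases h1 with ⟨hx, hy⟩ | ⟨hx, hy⟩
    · refine ⟨((k.natAbs, m.natAbs), true), by simpa using hmem, ?_⟩
      simp only [G, if_true, hr]
      rw [← hu, ← hv, ← hx, ← hy]; simp
    · refine ⟨((k.natAbs, m.natAbs), false), by simpa using hmem, ?_⟩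
      simp only [G, hr]
      rw [← hu, ← hv, ← hx, ← hy]; simp
  calc _ ≤ _ := Finset.card_le_card hsub
    _ ≤ _ := Finset.card_image_le
    _ = _ := by simp [Finset.card_product]

theorem latPts_bound (ε : ℝ) (hε : 0 < ε) :
    ∃ K : ℝ, 0 < K ∧ ∀ n : ℕ, 1 ≤ n → ((latPts n).card : ℝ) ≤ K * (n : ℝ) ^ (1 / 2 + ε) := by
  obtain ⟨K, hK, h⟩ := divisor_bound ε hε
  refine ⟨K * 4, by positivity, fun n hn => ?_⟩
  have h1 : ((latPts n).card : ℝ) ≤ n.divisors.card * (Nat.sqrt n + 1) * 2 := by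
    exact_mod_cast latPts_card_le n hn
  have hn1 : (1 : ℝ) ≤ n := by exact_mod_cast hn
  have h2 : (Nat.sqrt n : ℝ) ≤ (n : ℝ) ^ (1 / 2 : ℝ) := by
    rw [← Real.sqrt_eq_rpow]; exact Real.nat_sqrt_le_real_sqrt
  have h3 : (1 : ℝ) ≤ (n : ℝ) ^ (1 / 2 : ℝ) := Real.one_le_rpow hn1 (by norm_num)
  rw [Real.rpow_add (by linarith)]
  calc _ ≤ _ := h1
    _ ≤ (K * (n : ℝ) ^ ε) * ((n : ℝ) ^ (1 / 2 : ℝ) + (n : ℝ) ^ (1 / 2 : ℝ)) * 2 := by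
      gcongr
      exact h n hn
    _ = _ := by ring

/-- the `L¹` speed of the unit circle -/
noncomputable def spd (θ : ℝ) : ℝ := |Real.sin θ| + |Real.cos θ|

/-- boxes hit by an arc -/
def hit (n : ℕ) (a b : ℝ) : Set (ℤ × ℤ) :=
  {ij | ∃ θ ∈ Set.Icc a b, (Real.cos θ, Real.sin θ) ∈ boxInt n ij.1 ij.2}

theorem mem_boxInt_iff {n : ℕ} (hn : 1 ≤ n) (i j : ℤ) (x y : ℝ) :
    (x, y) ∈ boxInt n i j ↔
      (i : ℝ) < n * x ∧ n * x < i + 1 ∧ (j : ℝ) < n * y ∧ n * y < j + 1 := by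
  have hn' : (0 : ℝ) < n := by exact_mod_cast hn
  simp only [boxInt, Set.mem_ofPred_eq]
  rw [div_lt_iff₀ hn', lt_div_iff₀ hn', div_lt_iff₀ hn', lt_div_iff₀ hn', mul_comm x, mul_comm y]

theorem spd_cont : Continuous spd := by unfold spd; fun_prop

theorem spd_int (a b : ℝ) : IntervalIntegrable spd MeasureTheory.volume a b :=
  spd_cont.intervalIntegrable a b

theorem spd_nonneg (x : ℝ) : 0 ≤ spd x := by unfold spd; positivity

theorem spd_le (x : ℝ) : spd x ≤ 2 := by
  unfold spd
  linarith [Real.abs_sin_le_one x, Real.abs_cos_le_one x]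

theorem spd_integral_quadrant (a b : ℝ) (hab : a ≤ b) (s t : ℤ) (hs : s = 1 ∨ s = -1)
    (ht : t = 1 ∨ t = -1)
    (h : ∀ θ ∈ Set.Icc a b, 0 ≤ -(s : ℝ) * Real.sin θ ∧ 0 ≤ (t : ℝ) * Real.cos θ) :
    ∫ x in a..b, spd x = (s * Real.cos b + t * Real.sin b) - (s * Real.cos a + t * Real.sin a) := by
  have e : ∫ x in a..b, spd x = ∫ x in a..b, (-(s : ℝ) * Real.sin x + (t : ℝ) * Real.cos x) := by
    apply intervalIntegral.integral_congr
    intro x hx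
    rw [Set.uIcc_of_le hab] at hx
    obtain ⟨h1, h2⟩ := h x hx
    simp only [spd]
    congr 1
    · rw [← abs_of_nonneg h1, abs_mul]
      rcases hs with rfl | rfl <;> simp
    · rw [← abs_of_nonneg h2, abs_mul]
      rcases ht with rfl | rfl <;> simp
  rw [e]
  rw [intervalIntegral.integral_eq_sub_of_hasDerivAt
    (f := fun x => (s : ℝ) * Real.cos x + t * Real.sin x)]
  · intro x _
    have := ((Real.hasDerivAt_cos x).const_mul (s : ℝ)).add
      ((Real.hasDerivAt_sin x).const_mul (t : ℝ))
    exact this.congr_deriv (by ring)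
  · apply Continuous.intervalIntegrable; fun_prop

theorem hit_quadrant {n : ℕ} (hn : 1 ≤ n) (a b : ℝ) (hab : a ≤ b) (s t : ℤ)
    (hs : s = 1 ∨ s = -1) (ht : t = 1 ∨ t = -1)
    (h : ∀ θ ∈ Set.Icc a b, 0 ≤ -(s : ℝ) * Real.sin θ ∧ 0 ≤ (t : ℝ) * Real.cos θ) :
    (hit n a b).Finite ∧ ((hit n a b).ncard : ℝ) ≤ n * (∫ x in a..b, spd x) + 5 := by
  have hn' : (0 : ℝ) < n := by exact_mod_cast hn
  have mono : ∀ x y, a ≤ x → x ≤ y → y ≤ b →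
      (s : ℝ) * Real.cos x ≤ s * Real.cos y ∧ (t : ℝ) * Real.sin x ≤ t * Real.sin y := by
    have m1 : MonotoneOn (fun x => (s : ℝ) * Real.cos x) (Set.Icc a b) := by
      apply monotoneOn_of_deriv_nonneg (convex_Icc a b)
      · fun_prop
      · fun_prop
      · intro x hx
        have := (h x (interior_subset hx)).1
        simp
        linarith
    have m2 : MonotoneOn (fun x => (t : ℝ) * Real.sin x) (Set.Icc a b) := by
      apply monotoneOn_of_deriv_nonneg (convex_Icc a b)
      · fun_prop
      · fun_prop
      · intro x hx
        have := (h x (interior_subset hx)).2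
        simp
        linarith
    intro x y h1 h2 h3
    exact ⟨m1 ⟨h1, h2.trans h3⟩ ⟨h1.trans h2, h3⟩ h2, m2 ⟨h1, h2.trans h3⟩ ⟨h1.trans h2, h3⟩ h2⟩
  let g : ℤ × ℤ → ℤ := fun p => s * p.1 + t * p.2
  let u : ℝ → ℝ := fun x => s * Real.cos x + t * Real.sin x
  have tr : ∀ (s : ℤ), (s = 1 ∨ s = -1) → ∀ (i i' : ℤ) (x x' : ℝ), (i : ℝ) < n * x → n * x < i + 1 →
      (i' : ℝ) < n * x' → n * x' < i' + 1 → (s : ℝ) * x ≤ s * x' → s * i ≤ s * i' := by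
    intro s hs i i' x x' h1 h2 h3 h4 h5
    rcases hs with rfl | rfl
    · have : (n : ℝ) * x ≤ n * x' := by
        apply mul_le_mul_of_nonneg_left _ hn'.le
        simpa using h5
      have : (i : ℝ) < ((i' + 1 : ℤ) : ℝ) := by push_cast; linarith
      have := Int.cast_lt.mp this
      omega
    · have : (n : ℝ) * x' ≤ n * x := by
        apply mul_le_mul_of_nonneg_left _ hn'.le
        simpa using h5
      have : (i' : ℝ) < ((i + 1 : ℤ) : ℝ) := by push_cast; linarith
      have := Int.cast_lt.mp this
      omega
  have inj : Set.InjOn g (hit n a b) := by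
    have aux : ∀ p q : ℤ × ℤ, ∀ x y, a ≤ x → x ≤ y → y ≤ b →
        (Real.cos x, Real.sin x) ∈ boxInt n p.1 p.2 →
        (Real.cos y, Real.sin y) ∈ boxInt n q.1 q.2 → g p = g q → p = q := by
      intro p q x y h1 h2 h3 hp hq hg
      rw [mem_boxInt_iff hn] at hp hq
      obtain ⟨m1, m2⟩ := mono x y h1 h2 h3
      have r1 := tr s hs p.1 q.1 _ _ hp.1 hp.2.1 hq.1 hq.2.1 m1
      have r2 := tr t ht p.2 q.2 _ _ hp.2.2.1 hp.2.2.2 hq.2.2.1 hq.2.2.2 m2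
      simp only [g] at hg
      have e1 : s * p.1 = s * q.1 := by linarith
      have e2 : t * p.2 = t * q.2 := by linarith
      have hs0 : s ≠ 0 := by omega
      have ht0 : t ≠ 0 := by omega
      exact Prod.ext (mul_left_cancel₀ hs0 e1) (mul_left_cancel₀ ht0 e2)
    rintro p ⟨x, hx, hp⟩ q ⟨y, hy, hq⟩ hg
    rcases le_total x y with hxy | hxy
    · exact aux p q x y hx.1 hxy hy.2 hp hq hg
    · exact (aux q p y x hy.1 hxy hx.2 hq hp hg.symm).symm
  have near : ∀ (s : ℤ), (s = 1 ∨ s = -1) → ∀ (i : ℤ) (x : ℝ), (i : ℝ) < n * x → n * x < i + 1 →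
      (n : ℝ) * (s * x) - 1 ≤ s * i ∧ (s : ℝ) * i ≤ n * (s * x) + 1 := by
    intro s hs i x h1 h2
    rcases hs with rfl | rfl <;> push_cast <;> constructor <;> linarith
  have maps : Set.MapsTo g (hit n a b)
      ((Finset.Icc ⌈n * u a - 2⌉ ⌊n * u b + 2⌋ : Finset ℤ) : Set ℤ) := by
    rintro p ⟨x, hx, hp⟩
    rw [mem_boxInt_iff hn] at hp
    have r1 := near s hs p.1 _ hp.1 hp.2.1
    have r2 := near t ht p.2 _ hp.2.2.1 hp.2.2.2
    have m1 := mono a x le_rfl hx.1 hx.2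
    have m2 := mono x b hx.1 hx.2 le_rfl
    have m3 : n * u a ≤ n * u x := mul_le_mul_of_nonneg_left (by simp only [u]; linarith) hn'.le
    have m4 : n * u x ≤ n * u b := mul_le_mul_of_nonneg_left (by simp only [u]; linarith) hn'.le
    have m5 : n * u x = n * (s * Real.cos x) + n * (t * Real.sin x) := by simp only [u]; ring
    simp only [Finset.coe_Icc, Set.mem_Icc, Int.ceil_le, Int.le_floor, g]
    push_cast
    constructor <;> linarith
  have hfin : (hit n a b).Finite := Set.Finite.of_injOn maps inj (Finset.finite_toSet _)
  refine ⟨hfin, ?_⟩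
  have hc := Set.ncard_le_ncard_of_injOn g maps inj (Finset.finite_toSet _)
  rw [Set.ncard_coe_finset, Int.card_Icc] at hc
  rw [spd_integral_quadrant a b hab s t hs ht h]
  have hu : 0 ≤ n * (u b - u a) := by
    apply mul_nonneg hn'.le
    have := mono a b le_rfl hab le_rfl
    simp only [u]; linarith
  have hc' : ((hit n a b).ncard : ℝ) ≤ ((⌊n * u b + 2⌋ + 1 - ⌈n * u a - 2⌉).toNat : ℝ) := by
    exact_mod_cast hc
  refine hc'.trans ?_
  have e : ((⌊n * u b + 2⌋ + 1 - ⌈n * u a - 2⌉).toNat : ℝ) =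
      ((max (⌊n * u b + 2⌋ + 1 - ⌈n * u a - 2⌉) 0 : ℤ) : ℝ) := by
    rw [← Int.toNat_eq_max]; rfl
  rw [e]
  push_cast
  apply max_le
  · have := Int.floor_le (n * u b + 2)
    have := Int.le_ceil (n * u a - 2)
    simp only [u] at *
    linarith
  · simp only [u] at *
    linarith

theorem quadrant_signs (k : ℤ) : ∃ s t : ℤ, (s = 1 ∨ s = -1) ∧ (t = 1 ∨ t = -1) ∧
    ∀ θ ∈ Set.Icc ((k : ℝ) * (Real.pi / 2)) (((k : ℝ) + 1) * (Real.pi / 2)),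
      0 ≤ -(s : ℝ) * Real.sin θ ∧ 0 ≤ (t : ℝ) * Real.cos θ := by
  induction k using Int.induction_on with
  | zero =>
    refine ⟨-1, 1, Or.inr rfl, Or.inl rfl, ?_⟩
    intro θ hθ
    simp at hθ
    have := Real.pi_pos
    have h1 := Real.sin_nonneg_of_nonneg_of_le_pi hθ.1 (by linarith)
    have h2 := Real.cos_nonneg_of_neg_pi_div_two_le_of_le (x := θ) (by linarith) (by linarith)
    simpa using ⟨h1, h2⟩
  | succ k ih =>
    obtain ⟨s, t, hs, ht, h⟩ := ih
    refine ⟨-t, s, by omega, hs, ?_⟩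
    intro θ hθ
    push_cast at hθ h
    have := h (θ - Real.pi / 2) ⟨by linarith [hθ.1], by linarith [hθ.2]⟩
    rw [Real.sin_sub_pi_div_two, Real.cos_sub_pi_div_two] at this
    push_cast
    constructor <;> linarith [this.1, this.2]
  | pred k ih =>
    obtain ⟨s, t, hs, ht, h⟩ := ih
    refine ⟨t, -s, ht, by omega, ?_⟩
    intro θ hθ
    push_cast at hθ h
    have := h (θ + Real.pi / 2) ⟨by linarith [hθ.1], by linarith [hθ.2]⟩
    rw [Real.sin_add_pi_div_two, Real.cos_add_pi_div_two] at this
    push_cast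
    constructor <;> linarith [this.1, this.2]

theorem hit_subset (n : ℕ) (a c b : ℝ) : hit n a b ⊆ hit n a c ∪ hit n c b := by
  rintro p ⟨x, hx, hp⟩
  rcases le_total x c with h | h
  · exact Or.inl ⟨x, ⟨hx.1, h⟩, hp⟩
  · exact Or.inr ⟨x, ⟨h, hx.2⟩, hp⟩

theorem hit_multi {n : ℕ} (hn : 1 ≤ n) (k : ℤ) (m : ℕ) : ∀ a b : ℝ,
    (k : ℝ) * (Real.pi / 2) ≤ a → a ≤ b → b ≤ ((k : ℝ) + m + 1) * (Real.pi / 2) →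
    (hit n a b).Finite ∧ ((hit n a b).ncard : ℝ) ≤ n * (∫ x in a..b, spd x) + 5 * (m + 1) := by
  induction m with
  | zero =>
    intro a b h1 h2 h3
    obtain ⟨s, t, hs, ht, h⟩ := quadrant_signs k
    have := hit_quadrant hn a b h2 s t hs ht (fun θ hθ => h θ
      ⟨h1.trans hθ.1, hθ.2.trans (by simpa using h3)⟩)
    simpa using this
  | succ m ih =>
    intro a b h1 h2 h3
    push_cast at h3
    set c : ℝ := ((k : ℝ) + m + 1) * (Real.pi / 2) with hc
    rcases le_total b c with hbc | hbc
    · obtain ⟨f, hf⟩ := ih a b h1 h2 hbc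
      refine ⟨f, hf.trans ?_⟩
      push_cast; linarith
    · obtain ⟨s, t, hs, ht, h⟩ := quadrant_signs (k + m + 1)
      push_cast at h
      rw [← hc] at h
      rcases le_total a c with hac | hac
      · obtain ⟨f1, e1⟩ := ih a c h1 hac le_rfl
        obtain ⟨f2, e2⟩ := hit_quadrant hn c b hbc s t hs ht (fun θ hθ => h θ
          ⟨hθ.1, hθ.2.trans (by linarith)⟩)
        refine ⟨(f1.union f2).subset (hit_subset n a c b), ?_⟩
        have q1 : ((hit n a b).ncard : ℝ) ≤ (hit n a c).ncard + (hit n c b).ncard := by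
          exact_mod_cast (Set.ncard_le_ncard (hit_subset n a c b) (f1.union f2)).trans
            (Set.ncard_union_le _ _)
        have q2 := intervalIntegral.integral_add_adjacent_intervals (spd_int a c) (spd_int c b)
        rw [← q2]
        push_cast
        linarith
      · obtain ⟨f2, e2⟩ := hit_quadrant hn a b h2 s t hs ht (fun θ hθ => h θ
          ⟨hac.trans hθ.1, hθ.2.trans (by linarith)⟩)
        refine ⟨f2, e2.trans ?_⟩
        push_cast
        have : (0 : ℝ) ≤ m := by positivity
        linarith

theorem hit_bound {n : ℕ} (hn : 1 ≤ n) (a b : ℝ) (hab : a ≤ b) (hb : b ≤ a + 2 * Real.pi) :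
    (hit n a b).Finite ∧ ((hit n a b).ncard : ℝ) ≤ n * (∫ x in a..b, spd x) + 25 := by
  have hp : 0 < Real.pi / 2 := by positivity
  have h1 := Int.floor_le (a / (Real.pi / 2))
  have h2 := Int.lt_floor_add_one (a / (Real.pi / 2))
  rw [le_div_iff₀ hp] at h1
  rw [div_lt_iff₀ hp] at h2
  have := hit_multi hn ⌊a / (Real.pi / 2)⌋ 4 a b h1 hab (by push_cast; linarith)
  refine ⟨this.1, this.2.trans ?_⟩
  norm_num

theorem circle_param (x y : ℝ) (h : x ^ 2 + y ^ 2 = 1) (c : ℝ) :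
    ∃ θ ∈ Set.Icc c (c + 2 * Real.pi), Real.cos θ = x ∧ Real.sin θ = y := by
  have hn : ‖(⟨x, y⟩ : ℂ)‖ = 1 := by
    rw [Complex.norm_def, Complex.normSq_mk]
    rw [show x * x + y * y = 1 by linarith]; simp
  have hne : (⟨x, y⟩ : ℂ) ≠ 0 := by
    intro h0; rw [h0] at hn; simp at hn
  set φ := Complex.arg ⟨x, y⟩
  have hc : Real.cos φ = x := by
    have := Complex.cos_arg hne; rw [hn] at this; simpa using this
  have hs : Real.sin φ = y := by
    have := Complex.sin_arg ⟨x, y⟩; rw [hn] at this; simpa using this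
  refine ⟨toIcoMod Real.two_pi_pos c φ, ?_, ?_, ?_⟩
  · have := toIcoMod_mem_Ico Real.two_pi_pos c φ
    exact ⟨this.1, this.2.le⟩
  · rw [toIcoMod, zsmul_eq_mul, Real.cos_sub_int_mul_two_pi, hc]
  · rw [toIcoMod, zsmul_eq_mul, Real.sin_sub_int_mul_two_pi, hs]

theorem approx_eq_hit (n : ℕ) (c : ℝ) : approx n unitCircle = hit n c (c + 2 * Real.pi) := by
  ext p
  constructor
  · rintro ⟨⟨x, y⟩, hb, hc⟩
    obtain ⟨θ, hθ, rfl, rfl⟩ := circle_param x y hc c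
    exact ⟨θ, hθ, hb⟩
  · rintro ⟨θ, hθ, hb⟩
    exact ⟨_, hb, by simp [unitCircle]⟩

theorem diag_box {n : ℕ} (k : ℤ) (hk : k.natAbs < n)
    (hlat : ∀ p ∈ latPts n, (p.1 : ℤ) - p.2 ≠ k) :
    ∃ i j : ℕ, (i : ℤ) - j = k ∧ i ^ 2 + j ^ 2 < n ^ 2 ∧ n ^ 2 < (i + 1) ^ 2 + (j + 1) ^ 2 := by
  set p := k.toNat with hp
  set q := (-k).toNat with hq
  have hpq : (p : ℤ) - q = k := by omega
  have hpq2 : p ^ 2 + q ^ 2 < n ^ 2 := by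
    have : p = 0 ∧ q < n ∨ q = 0 ∧ p < n := by omega
    rcases this with ⟨h1, h2⟩ | ⟨h1, h2⟩ <;> rw [h1] <;> nlinarith
  have hex : ∃ m : ℕ, n ^ 2 ≤ (p + m) ^ 2 + (q + m) ^ 2 := ⟨n, by nlinarith⟩
  classical
  let m := Nat.find hex
  have hm : n ^ 2 ≤ (p + m) ^ 2 + (q + m) ^ 2 := Nat.find_spec hex
  have hm0 : m ≠ 0 := by
    intro h0; rw [h0] at hm; simp at hm; omega
  obtain ⟨l, hl⟩ := Nat.exists_eq_succ_of_ne_zero hm0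
  have hlm : ¬ n ^ 2 ≤ (p + l) ^ 2 + (q + l) ^ 2 := Nat.find_min hex (by change l < m; omega)
  refine ⟨p + l, q + l, by push_cast; linarith, by omega, ?_⟩
  rw [hl] at hm
  rcases hm.lt_or_eq with h | h
  · simpa [add_assoc] using h
  · exfalso
    have hle1 : p + l.succ ≤ n := by
      by_contra hcon
      push Not at hcon
      nlinarith
    have hle2 : q + l.succ ≤ n := by
      by_contra hcon
      push Not at hcon
      nlinarith
    apply hlat (p + l.succ, q + l.succ)
    · simp only [latPts, Finset.mem_filter, Finset.mem_product, Finset.mem_Icc]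
      exact ⟨⟨⟨by omega, hle1⟩, by omega, hle2⟩, h.symm⟩
    · push_cast; linarith

theorem box_of_diag {n : ℕ} (hn : 1 ≤ n) (i j : ℕ) (h1 : i ^ 2 + j ^ 2 < n ^ 2)
    (h2 : n ^ 2 < (i + 1) ^ 2 + (j + 1) ^ 2) (b c : Bool) :
    ((if b then (i : ℤ) else -1 - i), (if c then (j : ℤ) else -1 - j)) ∈ approx n unitCircle := by
  have hn' : (0 : ℝ) < n := by exact_mod_cast hn
  have h1' : (i : ℝ) ^ 2 + (j : ℝ) ^ 2 < (n : ℝ) ^ 2 := by exact_mod_cast h1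
  have h2' : (n : ℝ) ^ 2 < ((i : ℝ) + 1) ^ 2 + ((j : ℝ) + 1) ^ 2 := by exact_mod_cast h2
  have := intermediate_value_Ioo (f := fun t : ℝ => ((i : ℝ) + t) ^ 2 + ((j : ℝ) + t) ^ 2)
    (zero_le_one) (by fun_prop)
  obtain ⟨t, ht, hte⟩ := this (show (n : ℝ) ^ 2 ∈ _ from ⟨by simpa using h1', h2'⟩)
  simp only at hte
  obtain ⟨ht0, ht1⟩ := ht
  refine ⟨((if b then 1 else -1) * (i + t) / n, (if c then 1 else -1) * (j + t) / n), ?_, ?_⟩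
  · rw [mem_boxInt_iff hn, mul_div_cancel₀ _ hn'.ne', mul_div_cancel₀ _ hn'.ne']
    refine ⟨?_, ?_, ?_, ?_⟩ <;> cases b <;> cases c <;> simp <;> linarith
  · simp only [unitCircle, Set.mem_ofPred_eq, div_pow, mul_pow]
    rw [← add_div, div_eq_one_iff_eq (by positivity), ← hte]
    cases b <;> cases c <;> simp

theorem approx_finite {n : ℕ} (hn : 1 ≤ n) : (approx n unitCircle).Finite := by
  rw [approx_eq_hit n 0]
  exact (hit_bound hn 0 (0 + 2 * Real.pi) (by linarith [Real.pi_pos]) le_rfl).1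

theorem approx_lower {n : ℕ} (hn : 1 ≤ n) :
    (8 * n : ℝ) - 4 - 4 * (latPts n).card ≤ (approx n unitCircle).ncard := by
  classical
  let T : Finset ℤ := Finset.Ioo (-(n : ℤ)) n
  let G : Finset ℤ := T \ (latPts n).image (fun p => (p.1 : ℤ) - p.2)
  have hG : 2 * n - 1 ≤ G.card + (latPts n).card := by
    have h1 : T.card ≤ G.card + ((latPts n).image (fun p => (p.1 : ℤ) - p.2)).card := by
      have := Finset.le_card_sdiff ((latPts n).image (fun p => (p.1 : ℤ) - p.2)) T
      simp only [G]
      omega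
    have h2 : ((latPts n).image (fun p => (p.1 : ℤ) - p.2)).card ≤ (latPts n).card :=
      Finset.card_image_le
    have h3 : T.card = 2 * n - 1 := by
      simp only [T, Int.card_Ioo]; omega
    omega
  have hex : ∀ k : ℤ, ∃ ij : ℕ × ℕ, k ∈ G → (ij.1 : ℤ) - ij.2 = k ∧ ij.1 ^ 2 + ij.2 ^ 2 < n ^ 2 ∧
      n ^ 2 < (ij.1 + 1) ^ 2 + (ij.2 + 1) ^ 2 := by
    intro k
    by_cases hk : k ∈ G
    · simp only [G, T, Finset.mem_sdiff, Finset.mem_Ioo, Finset.mem_image, not_exists, not_and] at hk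
      obtain ⟨i, j, h⟩ := diag_box (n := n) k (by omega) (fun p hp => hk.2 p hp)
      exact ⟨(i, j), fun _ => h⟩
    · exact ⟨(0, 0), fun h => absurd h hk⟩
  choose F hF using hex
  let Φ : ℤ × (Bool × Bool) → ℤ × ℤ := fun q =>
    ((if q.2.1 then ((F q.1).1 : ℤ) else -1 - (F q.1).1),
      (if q.2.2 then ((F q.1).2 : ℤ) else -1 - (F q.1).2))
  let D : Finset (ℤ × (Bool × Bool)) := G ×ˢ Finset.univ
  have hmaps : Set.MapsTo Φ (D : Set (ℤ × (Bool × Bool))) (approx n unitCircle) := by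
    rintro ⟨k, b, c⟩ hq
    simp only [D, Finset.coe_product, Set.mem_prod, Finset.mem_coe] at hq
    obtain ⟨e1, e2, e3⟩ := hF k hq.1
    exact box_of_diag hn _ _ e2 e3 b c
  have hinj : Set.InjOn Φ (D : Set (ℤ × (Bool × Bool))) := by
    rintro ⟨k, b, c⟩ hq ⟨k', b', c'⟩ hq' he
    simp only [D, Finset.coe_product, Set.mem_prod, Finset.mem_coe] at hq hq'
    obtain ⟨e1, _⟩ := hF k hq.1
    obtain ⟨e1', _⟩ := hF k' hq'.1
    simp only [Φ, Prod.mk.injEq] at he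
    obtain ⟨he1, he2⟩ := he
    have hb : b = b' ∧ (F k).1 = (F k').1 := by
      cases b <;> cases b' <;> simp at he1 ⊢ <;> omega
    have hc : c = c' ∧ (F k).2 = (F k').2 := by
      cases c <;> cases c' <;> simp at he2 ⊢ <;> omega
    have : k = k' := by rw [← e1, ← e1', hb.2, hc.2]
    rw [this, hb.1, hc.1]
  have hcard := Set.ncard_le_ncard_of_injOn Φ hmaps hinj (approx_finite hn)
  rw [Set.ncard_coe_finset] at hcard
  have hD : D.card = G.card * 4 := by simp [D, Finset.card_product]
  have : 8 * n ≤ (approx n unitCircle).ncard + 4 + 4 * (latPts n).card := by omega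
  have : (8 * n : ℝ) ≤ (approx n unitCircle).ncard + 4 + 4 * (latPts n).card := by
    exact_mod_cast this
  linarith

theorem spd_periodic : Function.Periodic spd (Real.pi / 2) := by
  intro x
  unfold spd
  rw [Real.sin_add_pi_div_two, Real.cos_add_pi_div_two, abs_neg, add_comm]

theorem spd_periodic_two_pi : Function.Periodic spd (2 * Real.pi) := by
  have := spd_periodic.nat_mul 4
  rwa [show ((4 : ℕ) : ℝ) * (Real.pi / 2) = 2 * Real.pi by push_cast; ring] at this

/-- antiderivative of `spd` -/
noncomputable def Fa (x : ℝ) : ℝ := ∫ t in (0 : ℝ)..x, spd t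

theorem Fa_sub (a b : ℝ) : ∫ t in a..b, spd t = Fa b - Fa a :=
  (intervalIntegral.integral_interval_sub_left (spd_int _ _) (spd_int _ _)).symm

theorem Fa_quad (x : ℝ) (h0 : 0 ≤ x) (h1 : x ≤ Real.pi / 2) :
    Fa x = Real.sin x - Real.cos x + 1 := by
  have := spd_integral_quadrant 0 x h0 (-1) 1 (Or.inr rfl) (Or.inl rfl) (by
    intro θ hθ
    have := Real.pi_pos
    have h1 := Real.sin_nonneg_of_nonneg_of_le_pi hθ.1 (by linarith [hθ.2])
    have h2 := Real.cos_nonneg_of_neg_pi_div_two_le_of_le (x := θ) (by linarith [hθ.1])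
      (by linarith [hθ.2])
    simpa using ⟨h1, h2⟩)
  unfold Fa
  rw [this]
  simp
  ring

theorem Fa_shift (x : ℝ) : Fa (x + Real.pi / 2) = Fa x + 2 := by
  have h1 := Fa_sub x (x + Real.pi / 2)
  rw [spd_periodic.intervalIntegral_add_eq x 0, zero_add] at h1
  change Fa (Real.pi / 2) = _ at h1
  rw [Fa_quad _ (by positivity) le_rfl] at h1
  simp at h1
  linarith

theorem Fa_shift_two_pi (x : ℝ) : Fa (x + 2 * Real.pi) = Fa x + 8 := by
  rw [show x + 2 * Real.pi = x + Real.pi / 2 + Real.pi / 2 + Real.pi / 2 + Real.pi / 2 by ring,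
    Fa_shift, Fa_shift, Fa_shift, Fa_shift]
  ring

theorem Fa_quad2 (x : ℝ) (h0 : Real.pi / 2 ≤ x) (h1 : x ≤ Real.pi) :
    Fa x = 3 - Real.cos x - Real.sin x := by
  have := Fa_shift (x - Real.pi / 2)
  rw [sub_add_cancel, Fa_quad (x - Real.pi / 2) (by linarith) (by linarith), Real.sin_sub_pi_div_two,
    Real.cos_sub_pi_div_two] at this
  rw [this]; ring

theorem Fa_cont : Continuous Fa :=
  intervalIntegral.continuous_primitive spd_int 0

/-- `L¹` length of the near arc -/
noncomputable def Mn (φ : ℝ) : ℝ := Fa (φ + 2 * Real.pi / 3) - Fa (φ - 2 * Real.pi / 3)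

theorem Mn_cont : Continuous Mn := by
  unfold Mn
  have := Fa_cont
  fun_prop

theorem Mn_eq (φ : ℝ) : Mn φ = 6 + Fa (φ + Real.pi / 6) - Fa (φ + Real.pi / 3) := by
  unfold Mn
  have h1 := Fa_shift (φ + Real.pi / 6)
  have h2 := Fa_shift (φ - 2 * Real.pi / 3)
  have h3 := Fa_shift (φ - 2 * Real.pi / 3 + Real.pi / 2)
  rw [show φ + Real.pi / 6 + Real.pi / 2 = φ + 2 * Real.pi / 3 by ring] at h1
  rw [show φ - 2 * Real.pi / 3 + Real.pi / 2 + Real.pi / 2 = φ + Real.pi / 3 by ring] at h3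
  linarith

theorem Mn_periodic : Function.Periodic Mn (Real.pi / 2) := by
  intro x
  rw [Mn_eq, Mn_eq, show x + Real.pi / 2 + Real.pi / 6 = x + Real.pi / 6 + Real.pi / 2 by ring,
    show x + Real.pi / 2 + Real.pi / 3 = x + Real.pi / 3 + Real.pi / 2 by ring, Fa_shift, Fa_shift]
  ring

theorem J_eval (a : ℝ) (h0 : 0 ≤ a) (h1 : a ≤ Real.pi / 2) :
    ∫ x in (0 : ℝ)..(Real.pi / 2), spd x * Fa (x + a) =
      (Real.pi / 2 - a) * Real.sin a - 2 * Real.cos a + 2 * Real.sin a + 4 - a * Real.cos a := by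
  have hspd : ∀ x, 0 ≤ x → x ≤ Real.pi / 2 → spd x = Real.sin x + Real.cos x := by
    intro x hx hx'
    unfold spd
    rw [abs_of_nonneg (Real.sin_nonneg_of_nonneg_of_le_pi hx (by linarith [Real.pi_pos])),
      abs_of_nonneg (Real.cos_nonneg_of_neg_pi_div_two_le_of_le (by linarith [Real.pi_pos]) hx')]
  have hi : ∀ u v, IntervalIntegrable (fun x => spd x * Fa (x + a)) MeasureTheory.volume u v := by
    intro u v
    apply Continuous.intervalIntegrable
    have := Fa_cont
    have := spd_cont
    fun_prop
  have hd : ∀ x c : ℝ, HasDerivAt (fun x => 2 * x + c) 2 x := by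
    intro x c
    simpa using ((hasDerivAt_id x).const_mul 2).add_const c
  rw [← intervalIntegral.integral_add_adjacent_intervals (hi 0 (Real.pi / 2 - a)) (hi _ _)]
  have e1 : ∫ x in (0 : ℝ)..(Real.pi / 2 - a), spd x * Fa (x + a) =
      ∫ x in (0 : ℝ)..(Real.pi / 2 - a),
        (Real.sin a - Real.cos (2 * x + a) + Real.cos x + Real.sin x) := by
    apply intervalIntegral.integral_congr
    intro x hx
    rw [Set.uIcc_of_le (by linarith)] at hx
    simp only
    rw [hspd x hx.1 (by linarith [hx.2]), Fa_quad _ (by linarith [hx.1]) (by linarith [hx.2])]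
    have t1 : Real.sin a = Real.sin ((x + a) - x) := by ring_nf
    have t2 : Real.cos (2 * x + a) = Real.cos ((x + a) + x) := by ring_nf
    rw [t1, t2, Real.sin_sub, Real.cos_add (x + a) x]
    ring
  have e2 : ∫ x in (Real.pi / 2 - a)..(Real.pi / 2), spd x * Fa (x + a) =
      ∫ x in (Real.pi / 2 - a)..(Real.pi / 2),
        (3 * (Real.cos x + Real.sin x) - Real.sin (2 * x + a) - Real.cos a) := by
    apply intervalIntegral.integral_congr
    intro x hx
    rw [Set.uIcc_of_le (by linarith)] at hx
    simp only
    rw [hspd x (by linarith [hx.1]) (by linarith [hx.2]),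
      Fa_quad2 _ (by linarith [hx.1]) (by linarith [hx.2])]
    have t1 : Real.cos a = Real.cos ((x + a) - x) := by ring_nf
    have t2 : Real.sin (2 * x + a) = Real.sin ((x + a) + x) := by ring_nf
    rw [t1, t2, Real.cos_sub, Real.sin_add (x + a) x]
    ring
  rw [e1, e2]
  rw [intervalIntegral.integral_eq_sub_of_hasDerivAt
    (f := fun x => x * Real.sin a - Real.sin (2 * x + a) / 2 + Real.sin x - Real.cos x),
    intervalIntegral.integral_eq_sub_of_hasDerivAt
    (f := fun x => 3 * (Real.sin x - Real.cos x) + Real.cos (2 * x + a) / 2 - x * Real.cos a)]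
  · rw [show 2 * (Real.pi / 2 - a) + a = Real.pi - a by ring,
      show 2 * (Real.pi / 2) + a = a + Real.pi by ring]
    simp [Real.sin_pi_div_two_sub, Real.cos_pi_div_two_sub, Real.cos_pi_sub, Real.sin_pi_sub,
      Real.cos_add_pi]
    ring
  · intro x _
    have := (((Real.hasDerivAt_sin x).sub (Real.hasDerivAt_cos x)).const_mul 3).add
      (((hd x a).cos).div_const 2) |>.sub ((hasDerivAt_id x).mul_const (Real.cos a))
    exact this.congr_deriv (by ring)
  · apply Continuous.intervalIntegrable; fun_prop
  · intro x _
    have := (((hasDerivAt_id x).mul_const (Real.sin a)).sub (((hd x a).sin).div_const 2)).add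
      (Real.hasDerivAt_sin x) |>.sub (Real.hasDerivAt_cos x)
    exact this.congr_deriv (by ring)
  · apply Continuous.intervalIntegrable; fun_prop

theorem spd_Mn_integral :
    ∫ x in (0 : ℝ)..(2 * Real.pi), spd x * Mn x =
      64 - (24 + 24 * Real.sqrt 3 + Real.pi * (2 * Real.sqrt 3 - 4)) / 3 := by
  have hper : Function.Periodic (fun x => spd x * Mn x) (Real.pi / 2) :=
    fun x => by simp only [spd_periodic x, Mn_periodic x]
  have hc : Continuous (fun x => spd x * Mn x) := spd_cont.mul Mn_cont
  have h4 := hper.intervalIntegral_add_zsmul_eq 4 0 (fun a b => hc.intervalIntegrable a b)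
  have e0 : (0 : ℝ) + (4 : ℤ) • (Real.pi / 2) = 2 * Real.pi := by
    simp; ring
  rw [e0, zero_add] at h4
  rw [h4]
  have hFc := Fa_cont
  have hsc := spd_cont
  have e : ∫ x in (0 : ℝ)..(Real.pi / 2), spd x * Mn x =
      6 * (∫ x in (0 : ℝ)..(Real.pi / 2), spd x)
      + (∫ x in (0 : ℝ)..(Real.pi / 2), spd x * Fa (x + Real.pi / 6))
      - ∫ x in (0 : ℝ)..(Real.pi / 2), spd x * Fa (x + Real.pi / 3) := by
    rw [← intervalIntegral.integral_const_mul, ← intervalIntegral.integral_add,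
      ← intervalIntegral.integral_sub]
    · congr 1; ext x; rw [Mn_eq]; ring
    all_goals apply Continuous.intervalIntegrable; fun_prop
  have hp := Real.pi_pos
  rw [e, J_eval _ (by positivity) (by linarith), J_eval _ (by positivity) (by linarith)]
  have : ∫ x in (0 : ℝ)..(Real.pi / 2), spd x = 2 := by
    change Fa (Real.pi / 2) = 2
    rw [Fa_quad _ (by positivity) le_rfl]; simp; norm_num
  rw [this, Real.sin_pi_div_six, Real.cos_pi_div_six, Real.sin_pi_div_three,
    Real.cos_pi_div_three]
  simp
  ring

theorem Mn_nonneg (φ : ℝ) : 0 ≤ Mn φ := by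
  unfold Mn
  rw [← Fa_sub]
  exact intervalIntegral.integral_nonneg (by linarith [Real.pi_pos]) (fun x _ => spd_nonneg x)

theorem far_eq (φ : ℝ) :
    ∫ x in (φ + 2 * Real.pi / 3)..(φ + 4 * Real.pi / 3), spd x = 8 - Mn φ := by
  rw [Fa_sub]
  have := Fa_shift_two_pi (φ - 2 * Real.pi / 3)
  rw [show φ - 2 * Real.pi / 3 + 2 * Real.pi = φ + 4 * Real.pi / 3 by ring] at this
  unfold Mn
  rw [this]; ring

theorem Mn_le (φ : ℝ) : Mn φ ≤ 8 := by
  have h := far_eq φ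
  have : 0 ≤ ∫ x in (φ + 2 * Real.pi / 3)..(φ + 4 * Real.pi / 3), spd x :=
    intervalIntegral.integral_nonneg (by linarith [Real.pi_pos]) (fun x _ => spd_nonneg x)
  linarith

theorem cos_two_pi_div_three' : Real.cos (2 * Real.pi / 3) = -1 / 2 := by
  rw [show 2 * Real.pi / 3 = Real.pi - Real.pi / 3 by ring, Real.cos_pi_sub,
    Real.cos_pi_div_three]; ring

theorem near_angle (φ ψ : ℝ) (h : ψ ∈ Set.Icc (φ - Real.pi) (φ - Real.pi + 2 * Real.pi))
    (hc : -1 / 2 ≤ Real.cos (ψ - φ)) :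
    ψ ∈ Set.Icc (φ - 2 * Real.pi / 3) (φ + 2 * Real.pi / 3) := by
  have hp := Real.pi_pos
  have habs : |ψ - φ| ≤ 2 * Real.pi / 3 := by
    by_contra hcon
    push Not at hcon
    have h1 : |ψ - φ| ≤ Real.pi := abs_le.mpr ⟨by linarith [h.1], by linarith [h.2]⟩
    have := Real.cos_lt_cos_of_nonneg_of_le_pi (by positivity) h1 hcon
    rw [Real.cos_abs, cos_two_pi_div_three'] at this
    linarith
  rw [abs_le] at habs
  exact ⟨by linarith [habs.1], by linarith [habs.2]⟩

theorem near_cos (φ ψ : ℝ) (h : ψ ∈ Set.Icc (φ - 2 * Real.pi / 3) (φ + 2 * Real.pi / 3)) :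
    -1 / 2 ≤ Real.cos (ψ - φ) := by
  have hp := Real.pi_pos
  rw [← Real.cos_abs, ← cos_two_pi_div_three']
  apply Real.cos_le_cos_of_nonneg_of_le_pi (abs_nonneg _) (by linarith)
  exact abs_le.mpr ⟨by linarith [h.1], by linarith [h.2]⟩

theorem far_angle (φ ψ δ : ℝ) (hδ : 0 ≤ δ) (hδ' : δ ≤ Real.pi / 2)
    (h : ψ ∈ Set.Icc φ (φ + 2 * Real.pi))
    (hc : Real.cos (ψ - φ) < -1 / 2 + δ / 2) :
    ψ ∈ Set.Icc (φ + 2 * Real.pi / 3 - δ) (φ + 4 * Real.pi / 3 + δ) := by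
  have hp := Real.pi_pos
  have key : -1 / 2 + δ / 2 ≤ Real.cos (2 * Real.pi / 3 - δ) := by
    rw [Real.cos_sub, cos_two_pi_div_three']
    have hs : Real.sin (2 * Real.pi / 3) = Real.sqrt 3 / 2 := by
      rw [show 2 * Real.pi / 3 = Real.pi - Real.pi / 3 by ring, Real.sin_pi_sub,
        Real.sin_pi_div_three]
    rw [hs]
    have h1 := Real.mul_le_sin hδ hδ'
    have h2 := Real.cos_le_one δ
    have h3 : (1.7 : ℝ) ≤ Real.sqrt 3 := by
      rw [show (1.7 : ℝ) = Real.sqrt (1.7 ^ 2) by rw [Real.sqrt_sq (by norm_num)]]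
      exact Real.sqrt_le_sqrt (by norm_num)
    have h4 : δ / 2 ≤ Real.sqrt 3 / 2 * (2 / Real.pi * δ) := by
      have : (1 / 2 : ℝ) ≤ Real.sqrt 3 / Real.pi := by
        rw [le_div_iff₀ hp]
        linarith [Real.pi_lt_d2]
      calc δ / 2 = 1 / 2 * δ := by ring
        _ ≤ Real.sqrt 3 / Real.pi * δ := by gcongr
        _ = _ := by field_simp
    have h5 : Real.sqrt 3 / 2 * (2 / Real.pi * δ) ≤ Real.sqrt 3 / 2 * Real.sin δ := by gcongr
    linarith
  constructor
  · by_contra hcon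
    push Not at hcon
    have := Real.cos_le_cos_of_nonneg_of_le_pi (x := ψ - φ) (y := 2 * Real.pi / 3 - δ)
      (by linarith [h.1]) (by linarith) (by linarith)
    linarith
  · by_contra hcon
    push Not at hcon
    have := Real.cos_le_cos_of_nonneg_of_le_pi (x := 2 * Real.pi - (ψ - φ))
      (y := 2 * Real.pi / 3 - δ) (by linarith [h.2]) (by linarith) (by linarith)
    rw [Real.cos_two_pi_sub] at this
    linarith

theorem Mn_eq_indicator (φ : ℝ) :
    Mn φ = ∫ x in (0 : ℝ)..(2 * Real.pi),
      (if -1 / 2 ≤ Real.cos (x - φ) then spd x else 0) := by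
  have hp := Real.pi_pos
  have hper : Function.Periodic (fun x => if -1 / 2 ≤ Real.cos (x - φ) then spd x else 0)
      (2 * Real.pi) := by
    intro x
    simp only
    rw [spd_periodic_two_pi x, show x + 2 * Real.pi - φ = x - φ + 2 * Real.pi by ring,
      Real.cos_add_two_pi]
  have h1 := hper.intervalIntegral_add_eq 0 (φ - Real.pi)
  rw [zero_add] at h1
  rw [h1, intervalIntegral.integral_of_le (by linarith)]
  unfold Mn
  rw [← Fa_sub, intervalIntegral.integral_of_le (by linarith),
    ← MeasureTheory.integral_Icc_eq_integral_Ioc]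
  have hsub : Set.Icc (φ - 2 * Real.pi / 3) (φ + 2 * Real.pi / 3) ⊆
      Set.Ioc (φ - Real.pi) (φ - Real.pi + 2 * Real.pi) := by
    intro x hx
    exact ⟨by linarith [hx.1], by linarith [hx.2]⟩
  have h2 : ∫ x in Set.Ioc (φ - Real.pi) (φ - Real.pi + 2 * Real.pi),
      (if -1 / 2 ≤ Real.cos (x - φ) then spd x else 0) =
      ∫ x in Set.Ioc (φ - Real.pi) (φ - Real.pi + 2 * Real.pi),
        (Set.Icc (φ - 2 * Real.pi / 3) (φ + 2 * Real.pi / 3)).indicator spd x := by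
    apply MeasureTheory.setIntegral_congr_fun measurableSet_Ioc
    intro x hx
    simp only [Set.indicator]
    by_cases h : x ∈ Set.Icc (φ - 2 * Real.pi / 3) (φ + 2 * Real.pi / 3)
    · rw [if_pos h, if_pos (near_cos φ x h)]
    · rw [if_neg h, if_neg (fun hc => h (near_angle φ x ⟨hx.1.le, hx.2⟩ hc))]
  rw [h2, MeasureTheory.setIntegral_indicator measurableSet_Icc, Set.inter_eq_right.mpr hsub]

theorem ind_int (φ a b : ℝ) : IntervalIntegrable
    (fun x => if -1 / 2 ≤ Real.cos (x - φ) then spd x else 0) MeasureTheory.volume a b := by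
  have hm : MeasurableSet {x : ℝ | -1 / 2 ≤ Real.cos (x - φ)} :=
    measurableSet_le measurable_const (by fun_prop)
  apply (spd_int a b).mono_fun
  · apply Measurable.aestronglyMeasurable
    exact Measurable.ite hm spd_cont.measurable measurable_const
  · filter_upwards with x
    split_ifs <;> simp

/-- the chord relation between boxes -/
def chordRel (n : ℕ) (B B' : ℤ × ℤ) : Prop :=
  ∃ a ∈ boxInt n B.1 B.2, ∃ b ∈ boxInt n B'.1 B'.2,
      Real.sqrt ((a.1 - b.1) ^ 2 + (a.2 - b.2) ^ 2) > Real.sqrt 3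

theorem dist_sq_angles (θ ψ : ℝ) :
    (Real.cos θ - Real.cos ψ) ^ 2 + (Real.sin θ - Real.sin ψ) ^ 2 = 2 - 2 * Real.cos (ψ - θ) := by
  rw [Real.cos_sub]
  nlinarith [Real.sin_sq_add_cos_sq θ, Real.sin_sq_add_cos_sq ψ]

theorem not_chord_near {n : ℕ} (B B' : ℤ × ℤ) (θ : ℝ)
    (hθ : (Real.cos θ, Real.sin θ) ∈ boxInt n B.1 B.2) (hB' : B' ∈ approx n unitCircle)
    (h : ¬ chordRel n B B') : B' ∈ hit n (θ - 2 * Real.pi / 3) (θ + 2 * Real.pi / 3) := by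
  rw [approx_eq_hit n (θ - Real.pi)] at hB'
  obtain ⟨ψ, hψ, hb⟩ := hB'
  refine ⟨ψ, near_angle θ ψ hψ ?_, hb⟩
  by_contra hcon
  push Not at hcon
  apply h
  refine ⟨_, hθ, _, hb, ?_⟩
  apply Real.sqrt_lt_sqrt (by norm_num)
  simp only
  rw [dist_sq_angles]
  linarith

theorem chord_far {n : ℕ} (hn : 1 ≤ n) (B B' : ℤ × ℤ) (θ : ℝ)
    (hθ : (Real.cos θ, Real.sin θ) ∈ boxInt n B.1 B.2) (hB' : B' ∈ approx n unitCircle)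
    (h : chordRel n B B') (hδ : (24 / n : ℝ) ≤ Real.pi / 2) :
    B' ∈ hit n (θ + 2 * Real.pi / 3 - 24 / n) (θ + 4 * Real.pi / 3 + 24 / n) := by
  rw [approx_eq_hit n θ] at hB'
  obtain ⟨ψ, hψ, hb⟩ := hB'
  refine ⟨ψ, far_angle θ ψ _ (by positivity) hδ hψ ?_, hb⟩
  have hn' : (1 : ℝ) ≤ n := by exact_mod_cast hn
  obtain ⟨a, ha, b, hb', hab⟩ := h
  have hab' : 3 < (a.1 - b.1) ^ 2 + (a.2 - b.2) ^ 2 := by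
    by_contra hcon
    push Not at hcon
    exact absurd hab (not_lt.mpr (Real.sqrt_le_sqrt hcon))
  have hd := dist_sq_angles θ ψ
  set w : ℝ := 1 / n with hw
  have hw0 : 0 < w := by positivity
  have hw1 : w ≤ 1 := by rw [hw, div_le_one (by linarith)]; exact hn'
  have h24 : (24 / n : ℝ) = 24 * w := by rw [hw]; ring
  rw [h24]
  simp only [boxInt, Set.mem_ofPred_eq, add_div] at hθ hb ha hb'
  rw [← hw] at hθ hb ha hb'
  have step : ∀ P A : ℝ, |P| ≤ 2 → |A - P| ≤ 2 * w → A ^ 2 ≤ P ^ 2 + 12 * w := by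
    intro P A hP hA
    rw [abs_le] at hP hA
    nlinarith [mul_nonneg (sub_nonneg.mpr hA.1) (sub_nonneg.mpr hA.2), mul_nonneg (sub_nonneg.mpr hP.1) (sub_nonneg.mpr hA.2), mul_nonneg (sub_nonneg.mpr hP.2) (sub_nonneg.mpr hA.1), mul_nonneg (sub_nonneg.mpr hP.2) (sub_nonneg.mpr hA.2), mul_nonneg (sub_nonneg.mpr hP.1) (sub_nonneg.mpr hA.1), mul_le_mul_of_nonneg_left hw1 hw0.le]
  have c1 := Real.abs_cos_le_one θ
  have c2 := Real.abs_cos_le_one ψ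
  have c3 := Real.abs_sin_le_one θ
  have c4 := Real.abs_sin_le_one ψ
  rw [abs_le] at c1 c2 c3 c4
  have s1 := step (Real.cos θ - Real.cos ψ) (a.1 - b.1)
    (abs_le.mpr ⟨by linarith, by linarith⟩) (abs_le.mpr ⟨by linarith, by linarith⟩)
  have s2 := step (Real.sin θ - Real.sin ψ) (a.2 - b.2)
    (abs_le.mpr ⟨by linarith, by linarith⟩) (abs_le.mpr ⟨by linarith, by linarith⟩)
  linarith

theorem widened (φ δ : ℝ) (hδ : 0 ≤ δ) :
    ∫ x in (φ + 2 * Real.pi / 3 - δ)..(φ + 4 * Real.pi / 3 + δ), spd x ≤ 8 - Mn φ + 4 * δ := by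
  have hb : ∀ a b : ℝ, a ≤ b → ∫ x in a..b, spd x ≤ 2 * (b - a) := by
    intro a b hab
    have := intervalIntegral.integral_mono_on hab (spd_int a b)
      ((continuous_const (y := (2 : ℝ))).intervalIntegrable a b) (fun x _ => spd_le x)
    rw [intervalIntegral.integral_const, smul_eq_mul] at this
    linarith
  have h1 := hb (φ + 2 * Real.pi / 3 - δ) (φ + 2 * Real.pi / 3) (by linarith)
  have h2 := hb (φ + 4 * Real.pi / 3) (φ + 4 * Real.pi / 3 + δ) (by linarith)
  have h3 := far_eq φ
  rw [Fa_sub] at *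
  linarith

theorem approx_upper {n : ℕ} (hn : 1 ≤ n) : ((approx n unitCircle).ncard : ℝ) ≤ 8 * n + 25 := by
  rw [approx_eq_hit n 0]
  have := (hit_bound hn 0 (0 + 2 * Real.pi) (by linarith [Real.pi_pos]) le_rfl).2
  rw [Fa_sub, Fa_shift_two_pi] at this
  linarith

open Classical in
theorem chord_row {n : ℕ} (hn : 1 ≤ n) (S : Finset (ℤ × ℤ))
    (hS : (S : Set (ℤ × ℤ)) = approx n unitCircle) (B : ℤ × ℤ) (θ : ℝ)
    (hθ : (Real.cos θ, Real.sin θ) ∈ boxInt n B.1 B.2) :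
    (S.card : ℝ) - n * Mn θ - 25 ≤ ((S.filter (fun B' => chordRel n B B')).card : ℝ) ∧
    ((S.filter (fun B' => chordRel n B B')).card : ℝ) ≤ n * (8 - Mn θ) + 200 := by
  have hp := Real.pi_pos
  have hn' : (1 : ℝ) ≤ n := by exact_mod_cast hn
  have memS : ∀ B', B' ∈ S → B' ∈ approx n unitCircle := fun B' h => by rw [← hS]; exact h
  constructor
  · have h1 := Finset.card_filter_add_card_filter_not (s := S) (fun B' => chordRel n B B')
    have h1' : ((S.filter (fun B' => chordRel n B B')).card : ℝ) +
      ((S.filter (fun B' => ¬ chordRel n B B')).card : ℝ) = S.card := by exact_mod_cast h1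
    obtain ⟨f, hb⟩ := hit_bound hn (θ - 2 * Real.pi / 3) (θ + 2 * Real.pi / 3)
      (by linarith) (by linarith)
    rw [Fa_sub] at hb
    change _ ≤ n * Mn θ + 25 at hb
    have h2 : (S.filter (fun B' => ¬ chordRel n B B')).card ≤
        (hit n (θ - 2 * Real.pi / 3) (θ + 2 * Real.pi / 3)).ncard := by
      rw [← Set.ncard_coe_finset]
      apply Set.ncard_le_ncard _ f
      intro B' hB'
      rw [Finset.mem_coe, Finset.mem_filter] at hB'
      exact not_chord_near B B' θ hθ (memS B' hB'.1) hB'.2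
    have h2' : ((S.filter (fun B' => ¬ chordRel n B B')).card : ℝ) ≤
        (hit n (θ - 2 * Real.pi / 3) (θ + 2 * Real.pi / 3)).ncard := by exact_mod_cast h2
    linarith
  · by_cases hδ : (24 / n : ℝ) ≤ Real.pi / 2
    · obtain ⟨f, hb⟩ := hit_bound hn (θ + 2 * Real.pi / 3 - 24 / n) (θ + 4 * Real.pi / 3 + 24 / n)
        (by have : (0 : ℝ) ≤ 24 / n := by positivity
            linarith) (by linarith)
      have h2 : (S.filter (fun B' => chordRel n B B')).card ≤
          (hit n (θ + 2 * Real.pi / 3 - 24 / n) (θ + 4 * Real.pi / 3 + 24 / n)).ncard := by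
        rw [← Set.ncard_coe_finset]
        apply Set.ncard_le_ncard _ f
        intro B' hB'
        rw [Finset.mem_coe, Finset.mem_filter] at hB'
        exact chord_far hn B B' θ hθ (memS B' hB'.1) hB'.2 hδ
      have h2' : ((S.filter (fun B' => chordRel n B B')).card : ℝ) ≤
          (hit n (θ + 2 * Real.pi / 3 - 24 / n) (θ + 4 * Real.pi / 3 + 24 / n)).ncard := by
        exact_mod_cast h2
      have hw := widened θ (24 / n) (by positivity)
      have hw' := mul_le_mul_of_nonneg_left hw (by linarith : (0 : ℝ) ≤ n)
      have e : (n : ℝ) * (8 - Mn θ + 4 * (24 / n)) = n * (8 - Mn θ) + 96 := by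
        field_simp; ring
      linarith
    · push Not at hδ
      have hn16 : (n : ℝ) < 17 := by
        rw [lt_div_iff₀ (by linarith)] at hδ
        nlinarith [Real.pi_gt_three]
      have h3 : ((S.filter (fun B' => chordRel n B B')).card : ℝ) ≤ S.card := by
        exact_mod_cast Finset.card_filter_le _ _
      have h4 := approx_upper hn
      rw [← hS, Set.ncard_coe_finset] at h4
      have h5 : (n : ℝ) * (8 - Mn θ) ≥ 0 := mul_nonneg (by linarith) (by linarith [Mn_le θ])
      linarith

theorem near_count {n : ℕ} (hn : 1 ≤ n) (S : Finset (ℤ × ℤ))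
    (T : ℤ × ℤ → ℝ)
    (hT : ∀ B ∈ S, (Real.cos (T B), Real.sin (T B)) ∈ boxInt n B.1 B.2) (ψ : ℝ) :
    ((S.filter (fun B => -1 / 2 ≤ Real.cos (ψ - T B))).card : ℝ) ≤ n * Mn ψ + 25 ∧
    (S.card : ℝ) - n * (8 - Mn ψ) - 25 ≤
      ((S.filter (fun B => -1 / 2 ≤ Real.cos (ψ - T B))).card : ℝ) := by
  have hp := Real.pi_pos
  have par : ∀ B c, ∃ θ ∈ Set.Icc c (c + 2 * Real.pi), Real.cos θ = Real.cos (T B) ∧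
      Real.sin θ = Real.sin (T B) := fun B c =>
    circle_param _ _ (Real.cos_sq_add_sin_sq (T B)) c
  constructor
  · obtain ⟨f, hb⟩ := hit_bound hn (ψ - 2 * Real.pi / 3) (ψ + 2 * Real.pi / 3)
      (by linarith) (by linarith)
    rw [Fa_sub] at hb
    change _ ≤ n * Mn ψ + 25 at hb
    refine le_trans ?_ hb
    rw [← Set.ncard_coe_finset]
    apply Nat.cast_le.mpr
    apply Set.ncard_le_ncard _ f
    intro B hB
    rw [Finset.mem_coe, Finset.mem_filter] at hB
    obtain ⟨θ, hθ, hc, hs⟩ := par B (ψ - Real.pi)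
    refine ⟨θ, near_angle ψ θ hθ ?_, ?_⟩
    · have := hB.2
      rw [Real.cos_sub] at this ⊢
      rw [hc, hs]; linarith
    · rw [hc, hs]; exact hT B hB.1
  · have h1 := Finset.card_filter_add_card_filter_not (s := S)
      (fun B => -1 / 2 ≤ Real.cos (ψ - T B))
    have h1' : ((S.filter (fun B => -1 / 2 ≤ Real.cos (ψ - T B))).card : ℝ) +
      ((S.filter (fun B => ¬ -1 / 2 ≤ Real.cos (ψ - T B))).card : ℝ) = S.card := by
        exact_mod_cast h1
    obtain ⟨f, hb⟩ := hit_bound hn (ψ + 2 * Real.pi / 3) (ψ + 4 * Real.pi / 3)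
      (by linarith) (by linarith)
    rw [far_eq] at hb
    have h2 : ((S.filter (fun B => ¬ -1 / 2 ≤ Real.cos (ψ - T B))).card : ℝ) ≤
        (hit n (ψ + 2 * Real.pi / 3) (ψ + 4 * Real.pi / 3)).ncard := by
      rw [← Set.ncard_coe_finset]
      apply Nat.cast_le.mpr
      apply Set.ncard_le_ncard _ f
      intro B hB
      rw [Finset.mem_coe, Finset.mem_filter] at hB
      obtain ⟨θ, hθ, hc, hs⟩ := par B ψ
      refine ⟨θ, ?_, ?_⟩
      · have := far_angle ψ θ 0 le_rfl (by positivity) hθ (by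
          have := hB.2
          rw [Real.cos_sub] at this ⊢
          rw [hc, hs]
          push Not at this
          linarith)
        simpa using this
      · rw [hc, hs]; exact hT B hB.1
    linarith

theorem sum_Mn {n : ℕ} (hn : 1 ≤ n) (S : Finset (ℤ × ℤ)) (T : ℤ × ℤ → ℝ)
    (hT : ∀ B ∈ S, (Real.cos (T B), Real.sin (T B)) ∈ boxInt n B.1 B.2)
    (E : ℝ) (hE : 25 ≤ E) (hS : 8 * (n : ℝ) - (E - 25) ≤ S.card) :
    |∑ B ∈ S, Mn (T B) - n * ∫ x in (0 : ℝ)..(2 * Real.pi), spd x * Mn x| ≤ 8 * E := by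
  have hp := Real.pi_pos
  have e1 : ∑ B ∈ S, Mn (T B) = ∫ x in (0 : ℝ)..(2 * Real.pi),
      spd x * ((S.filter (fun B => -1 / 2 ≤ Real.cos (x - T B))).card : ℝ) := by
    have : ∀ B ∈ S, Mn (T B) = ∫ x in (0 : ℝ)..(2 * Real.pi),
      (if -1 / 2 ≤ Real.cos (x - T B) then spd x else 0) := fun B _ => Mn_eq_indicator (T B)
    rw [Finset.sum_congr rfl this, ← intervalIntegral.integral_finsetSum
      (fun B _ => ind_int (T B) _ _)]
    congr 1
    ext x
    rw [← Finset.sum_filter, Finset.sum_const, nsmul_eq_mul, mul_comm]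
  have hintg : IntervalIntegrable (fun x => spd x *
      ((S.filter (fun B => -1 / 2 ≤ Real.cos (x - T B))).card : ℝ)) MeasureTheory.volume
      0 (2 * Real.pi) := by
    have : (fun x => spd x * ((S.filter (fun B => -1 / 2 ≤ Real.cos (x - T B))).card : ℝ)) =
        ∑ B ∈ S, (fun x => if -1 / 2 ≤ Real.cos (x - T B) then spd x else 0) := by
      ext x
      rw [Finset.sum_apply, ← Finset.sum_filter, Finset.sum_const, nsmul_eq_mul, mul_comm]
    rw [this]
    exact IntervalIntegrable.sum S (fun B _ => ind_int (T B) _ _)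
  have hintg2 : IntervalIntegrable (fun x => spd x * Mn x) MeasureTheory.volume
      0 (2 * Real.pi) := (spd_cont.mul Mn_cont).intervalIntegrable _ _
  rw [e1, ← intervalIntegral.integral_const_mul, ← intervalIntegral.integral_sub hintg
    (hintg2.const_mul _)]
  have hbound := intervalIntegral.norm_integral_le_of_norm_le
    (f := fun x => spd x * ((S.filter (fun B => -1 / 2 ≤ Real.cos (x - T B))).card : ℝ) -
      n * (spd x * Mn x)) (g := fun x => E * spd x) (μ := MeasureTheory.volume)
    (a := 0) (b := 2 * Real.pi) (by linarith) (by
      filter_upwards with x _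
      obtain ⟨h1, h2⟩ := near_count hn S T hT x
      rw [show spd x * ((S.filter (fun B => -1 / 2 ≤ Real.cos (x - T B))).card : ℝ) -
        n * (spd x * Mn x) = (((S.filter (fun B => -1 / 2 ≤ Real.cos (x - T B))).card : ℝ)
          - n * Mn x) * spd x by ring, norm_mul, Real.norm_eq_abs, Real.norm_eq_abs,
          abs_of_nonneg (spd_nonneg x)]
      apply mul_le_mul_of_nonneg_right _ (spd_nonneg x)
      rw [abs_le]
      constructor <;> linarith) ((spd_int _ _).const_mul E)
  rw [Real.norm_eq_abs] at hbound
  refine hbound.trans ?_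
  rw [intervalIntegral.integral_const_mul]
  have := Fa_shift_two_pi 0
  rw [zero_add] at this
  have h0 : Fa 0 = 0 := by simp [Fa]
  change E * Fa (2 * Real.pi) ≤ _
  rw [this, h0]
  linarith

theorem chords_card {n : ℕ} (hn : 1 ≤ n) :
    |((longChords n).ncard : ℝ)
        - ((24 + 24 * Real.sqrt 3 + Real.pi * (2 * Real.sqrt 3 - 4)) / 3) * (n : ℝ) ^ 2| ≤
      57 * (n : ℝ) * (4 * ((latPts n).card : ℝ) + 204) := by
  classical
  have hn' : (1 : ℝ) ≤ n := by exact_mod_cast hn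
  have hfin := approx_finite hn
  set S : Finset (ℤ × ℤ) := hfin.toFinset with hSdef
  have hS : (S : Set (ℤ × ℤ)) = approx n unitCircle := by simp [S]
  have hex : ∀ B : ℤ × ℤ, ∃ θ : ℝ, B ∈ S → (Real.cos θ, Real.sin θ) ∈ boxInt n B.1 B.2 := by
    intro B
    by_cases hB : B ∈ S
    · have : B ∈ approx n unitCircle := by rw [← hS]; exact hB
      rw [approx_eq_hit n 0] at this
      obtain ⟨θ, _, h⟩ := this
      exact ⟨θ, fun _ => h⟩
    · exact ⟨0, fun h => absurd h hB⟩
  choose T hT using hex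
  have hlow := approx_lower hn
  have hup := approx_upper hn
  rw [← hS, Set.ncard_coe_finset] at hlow hup
  set L : ℝ := ((latPts n).card : ℝ)
  have hL : 0 ≤ L := by positivity
  set N : ℝ := (S.card : ℝ)
  have hcard : ((longChords n).ncard : ℝ) =
      ∑ B ∈ S, ((S.filter (fun B' => chordRel n B B')).card : ℝ) := by
    have : longChords n = (((S ×ˢ S).filter (fun q => chordRel n q.1 q.2) :
        Finset ((ℤ × ℤ) × (ℤ × ℤ))) : Set ((ℤ × ℤ) × (ℤ × ℤ))) := by
      ext ⟨B, B'⟩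
      simp only [Finset.coe_filter, Finset.mem_product, Set.mem_ofPred_eq]
      rw [← Finset.mem_coe (a := B), ← Finset.mem_coe (a := B'), hS, and_assoc]
      rfl
    rw [this, Set.ncard_coe_finset, Finset.card_filter, Finset.sum_product]
    push_cast
    apply Finset.sum_congr rfl
    intro B _
    rw [Finset.card_filter]
    push_cast
    rfl
  have hrow : |∑ B ∈ S, ((S.filter (fun B' => chordRel n B B')).card : ℝ) -
      ∑ B ∈ S, (n : ℝ) * (8 - Mn (T B))| ≤ N * (4 * L + 204) := by
    rw [← Finset.sum_sub_distrib]
    refine (Finset.abs_sum_le_sum_abs _ _).trans ?_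
    rw [← nsmul_eq_mul]
    apply Finset.sum_le_card_nsmul
    intro B hB
    obtain ⟨h1, h2⟩ := chord_row hn S hS B (T B) (hT B hB)
    rw [abs_le]
    constructor <;> linarith
  have hsum : ∑ B ∈ S, (n : ℝ) * (8 - Mn (T B)) = 8 * n * N - n * ∑ B ∈ S, Mn (T B) := by
    rw [← Finset.mul_sum, Finset.sum_sub_distrib, Finset.sum_const, nsmul_eq_mul]
    ring
  have hM := sum_Mn hn S T hT (4 * L + 29) (by linarith) (by linarith)
  rw [spd_Mn_integral] at hM
  rw [hcard]
  rw [hsum] at hrow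
  set c : ℝ := (24 + 24 * Real.sqrt 3 + Real.pi * (2 * Real.sqrt 3 - 4)) / 3
  set X := ∑ B ∈ S, ((S.filter (fun B' => chordRel n B B')).card : ℝ)
  set Y := ∑ B ∈ S, Mn (T B)
  rw [abs_le] at hrow hM ⊢
  have m1 := mul_le_mul_of_nonneg_left hM.1 (by linarith : (0 : ℝ) ≤ n)
  have m2 := mul_le_mul_of_nonneg_left hM.2 (by linarith : (0 : ℝ) ≤ n)
  have m3 : N * (4 * L + 204) ≤ (33 * n) * (4 * L + 204) :=
    mul_le_mul_of_nonneg_right (by linarith) (by linarith)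
  have m4 := mul_le_mul_of_nonneg_left hlow (by linarith : (0 : ℝ) ≤ 8 * n)
  have m5 := mul_le_mul_of_nonneg_left hup (by linarith : (0 : ℝ) ≤ 8 * n)
  have m6 : 0 ≤ n * L := by positivity
  constructor <;> nlinarith

theorem longChords_asymptotics (ε : ℝ) (hε : 0 < ε) :
    ∃ K : ℝ, ∀ n : ℕ, 1 ≤ n →
      |((longChords n).ncard : ℝ)
        - ((24 + 24 * Real.sqrt 3 + Real.pi * (2 * Real.sqrt 3 - 4)) / 3) * (n : ℝ) ^ 2|
      ≤ K * (n : ℝ) ^ ((3 : ℝ) / 2 + ε) := by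
  obtain ⟨K, hK, h⟩ := latPts_bound ε hε
  refine ⟨57 * (4 * K + 204), fun n hn => (chords_card hn).trans ?_⟩
  have hn' : (1 : ℝ) ≤ n := by exact_mod_cast hn
  have h1 := h n hn
  have h2 : (1 : ℝ) ≤ (n : ℝ) ^ (1 / 2 + ε) := Real.one_le_rpow hn' (by positivity)
  have e : (n : ℝ) ^ ((3 : ℝ) / 2 + ε) = n * (n : ℝ) ^ (1 / 2 + ε) := by
    rw [show (3 : ℝ) / 2 + ε = 1 + (1 / 2 + ε) by ring, Real.rpow_add (by linarith),
      Real.rpow_one]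
  rw [e]
  calc 57 * (n : ℝ) * (4 * (latPts n).card + 204)
      ≤ 57 * n * (4 * (K * (n : ℝ) ^ (1 / 2 + ε)) + 204 * (n : ℝ) ^ (1 / 2 + ε)) := by
        gcongr
        linarith
    _ = _ := by ring
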